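/- (Key lemma for Theorem 2.) Let n ≥ 1, p > 1, let G = (G¹,…,Gⁿ) : ℝⁿ × ℝⁿ → ℝⁿ have C¹ components, and let L : ℝⁿ × (ℝⁿ∖{0}) → ℝ be C² with L(x,y) > 0 and positively homogeneous of degree p in the fiber variable: L(x, r·y) = r^p·L(x,y) for all r > 0 and all (x,y) with y ≠ 0. If the wedge product d_J L ∧ δ_S L vanishes, i.e. ∂L/∂y^i(x,y)·(δ_S L)_j(x,y) = ∂L/∂y^j(x,y)·(δ_S L)_i(x,y) for all indices i, j and all (x,y) with y ≠ 0, then p·L(x,y)·(δ_S L)_j(x,y) = (p−1)·S(L)(x,y)·∂L/∂y^j(x,y) for every index j and every (x,y) with y ≠ 0 (i.e. δ_S L = (1 − 1/p)·(S(L)/L)·d_J L). -/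

import Mathlib

open scoped BigOperators

noncomputable section

/-- Partial derivative of `f` in the `i`-th base coordinate `x^i`. -/
def pdx (n : ℕ) (f : ((Fin n → ℝ) × (Fin n → ℝ)) → ℝ) (i : Fin n)
    (p : (Fin n → ℝ) × (Fin n → ℝ)) : ℝ :=
  fderiv ℝ f p (Pi.single i 1, 0)

/-- Partial derivative of `f` in the `i`-th fiber coordinate `y^i`. -/
def pdy (n : ℕ) (f : ((Fin n → ℝ) × (Fin n → ℝ)) → ℝ) (i : Fin n)
    (p : (Fin n → ℝ) × (Fin n → ℝ)) : ℝ :=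
  fderiv ℝ f p (0, Pi.single i 1)

/-- The semi-spray with coefficients `G`, acting on functions:
`S(f) = Σ_k y^k ∂f/∂x^k − 2 Σ_k G^k ∂f/∂y^k`. -/
def sprayD (n : ℕ) (G : Fin n → ((Fin n → ℝ) × (Fin n → ℝ)) → ℝ)
    (f : ((Fin n → ℝ) × (Fin n → ℝ)) → ℝ) (p : (Fin n → ℝ) × (Fin n → ℝ)) : ℝ :=
  (∑ k, p.2 k * pdx n f k p) - 2 * ∑ k, G k p * pdy n f k p

/-- The Liouville operator `C(f) = Σ_k y^k ∂f/∂y^k`. -/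
def liouvilleOp (n : ℕ) (f : ((Fin n → ℝ) × (Fin n → ℝ)) → ℝ)
    (p : (Fin n → ℝ) × (Fin n → ℝ)) : ℝ :=
  ∑ k, p.2 k * pdy n f k p

/-- The `i`-th component of the Lagrange differential
`(δ_S L)_i = S(∂L/∂y^i) − ∂L/∂x^i`. -/
def lagDiff (n : ℕ) (G : Fin n → ((Fin n → ℝ) × (Fin n → ℝ)) → ℝ)
    (L : ((Fin n → ℝ) × (Fin n → ℝ)) → ℝ) (i : Fin n)
    (p : (Fin n → ℝ) × (Fin n → ℝ)) : ℝ :=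
  sprayD n G (pdy n L i) p - pdx n L i p

/-- The Lagrangian energy `E_L = C(L) − L`. -/
def lagEnergy (n : ℕ) (L : ((Fin n → ℝ) × (Fin n → ℝ)) → ℝ)
    (p : (Fin n → ℝ) × (Fin n → ℝ)) : ℝ :=
  liouvilleOp n L p - L p

end

theorem aux_fderiv_fst (n : ℕ) (A : ((Fin n → ℝ) × (Fin n → ℝ)) →L[ℝ] ℝ) (v : Fin n → ℝ) :
    ∑ k, v k * A (Pi.single k 1, 0) = A (v, 0) := by
  have h : (v, (0 : Fin n → ℝ)) = ∑ k, v k • ((Pi.single k 1, 0) : (Fin n → ℝ) × (Fin n → ℝ)) := by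
    ext i
    · simp [Prod.fst_sum, Finset.sum_apply, Pi.single_apply]
    · simp [Prod.snd_sum, Finset.sum_apply]
  rw [h, map_sum]
  simp only [map_smul, smul_eq_mul]

theorem aux_fderiv_snd (n : ℕ) (A : ((Fin n → ℝ) × (Fin n → ℝ)) →L[ℝ] ℝ) (v : Fin n → ℝ) :
    ∑ k, v k * A (0, Pi.single k 1) = A (0, v) := by
  have h : ((0 : Fin n → ℝ), v) = ∑ k, v k • ((0, Pi.single k 1) : (Fin n → ℝ) × (Fin n → ℝ)) := by
    ext i
    · simp [Prod.fst_sum, Finset.sum_apply]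
    · simp [Prod.snd_sum, Finset.sum_apply, Pi.single_apply]
  rw [h, map_sum]
  simp only [map_smul, smul_eq_mul]

theorem aux_spray (n : ℕ) (G : Fin n → ((Fin n → ℝ) × (Fin n → ℝ)) → ℝ)
    (f : ((Fin n → ℝ) × (Fin n → ℝ)) → ℝ) (q : (Fin n → ℝ) × (Fin n → ℝ)) :
    sprayD n G f q = fderiv ℝ f q (q.2, fun k => -2 * G k q) := by
  have h : (q.2, fun k => -2 * G k q) = (q.2, (0 : Fin n → ℝ)) + (0, fun k => -2 * G k q) := by
    simp
  rw [h, map_add, ← aux_fderiv_fst, ← aux_fderiv_snd]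
  simp only [sprayD, pdx, pdy, mul_assoc, ← Finset.mul_sum]
  ring

theorem stmt9 (n : ℕ) (hn : 1 ≤ n) (pp : ℝ) (hp : 1 < pp)
    (G : Fin n → ((Fin n → ℝ) × (Fin n → ℝ)) → ℝ) (hG : ∀ k, ContDiff ℝ 1 (G k))
    (L : ((Fin n → ℝ) × (Fin n → ℝ)) → ℝ)
    (hL : ContDiffOn ℝ 2 L {q : (Fin n → ℝ) × (Fin n → ℝ) | q.2 ≠ 0})
    (hLpos : ∀ q : (Fin n → ℝ) × (Fin n → ℝ), q.2 ≠ 0 → 0 < L q)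
    (hhom : ∀ r : ℝ, 0 < r → ∀ q : (Fin n → ℝ) × (Fin n → ℝ), q.2 ≠ 0 →
      L (q.1, r • q.2) = r ^ pp * L q)
    (hwedge : ∀ (i j : Fin n) (q : (Fin n → ℝ) × (Fin n → ℝ)), q.2 ≠ 0 →
      pdy n L i q * lagDiff n G L j q = pdy n L j q * lagDiff n G L i q) :
    ∀ (j : Fin n) (q : (Fin n → ℝ) × (Fin n → ℝ)), q.2 ≠ 0 →
      pp * L q * lagDiff n G L j q =
        (pp - 1) * sprayD n G L q * pdy n L j q := by
  have hopen : IsOpen {q : (Fin n → ℝ) × (Fin n → ℝ) | q.2 ≠ 0} :=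
    isOpen_ne_fun continuous_snd continuous_const
  have hcd : ∀ q : (Fin n → ℝ) × (Fin n → ℝ), q.2 ≠ 0 → ContDiffAt ℝ 2 L q :=
    fun q hq => hL.contDiffAt (hopen.mem_nhds hq)
  have hdiff : ∀ q : (Fin n → ℝ) × (Fin n → ℝ), q.2 ≠ 0 → DifferentiableAt ℝ L q :=
    fun q hq => (hcd q hq).differentiableAt (by norm_num)
  have euler : ∀ q : (Fin n → ℝ) × (Fin n → ℝ), q.2 ≠ 0 →
      ∑ k, q.2 k * pdy n L k q = pp * L q := by
    intro q hq
    have h0 := aux_fderiv_snd n (fderiv ℝ L q) q.2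
    simp only [pdy]
    rw [h0]
    have hc : HasDerivAt (fun r : ℝ => (q.1, r • q.2)) ((0 : Fin n → ℝ), q.2) 1 := by
      have h2 : HasDerivAt (fun r : ℝ => r • q.2) ((1 : ℝ) • q.2) 1 :=
        (hasDerivAt_id (1 : ℝ)).smul_const q.2
      rw [one_smul] at h2
      exact (hasDerivAt_const (1 : ℝ) q.1).prodMk h2
    have h1 : HasFDerivAt L (fderiv ℝ L q) ((fun r : ℝ => (q.1, r • q.2)) 1) := by
      simpa using (hdiff q hq).hasFDerivAt
    have h3 := h1.comp_hasDerivAt (1 : ℝ) hc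
    have h4 : HasDerivAt (fun r : ℝ => r ^ pp * L q) (pp * L q) 1 := by
      have := (Real.hasDerivAt_rpow_const (x := 1) (p := pp) (Or.inl one_ne_zero)).mul_const (L q)
      simpa using this
    refine h3.unique (h4.congr_of_eventuallyEq ?_)
    filter_upwards [lt_mem_nhds (zero_lt_one (α := ℝ))] with r hr
    exact hhom r hr q hq
  intro j q hq
  have hpd : ∀ i, DifferentiableAt ℝ (pdy n L i) q := by
    intro i
    have : DifferentiableAt ℝ (fderiv ℝ L) q :=
      ((hcd q hq).fderiv_right (m := 1) (by norm_num)).differentiableAt (by norm_num)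
    exact this.clm_apply (differentiableAt_const _)
  have hcoord : ∀ i : Fin n, HasFDerivAt (fun z : (Fin n → ℝ) × (Fin n → ℝ) => z.2 i)
      ((ContinuousLinearMap.proj i).comp (ContinuousLinearMap.snd ℝ (Fin n → ℝ) (Fin n → ℝ))) q :=
    fun i => ((ContinuousLinearMap.proj (R := ℝ) (φ := fun _ : Fin n => ℝ) i).comp
      (ContinuousLinearMap.snd ℝ (Fin n → ℝ) (Fin n → ℝ))).hasFDerivAt
  have hs := HasFDerivAt.fun_sum (u := Finset.univ)
    (fun i _ => (hcoord i).mul (hpd i).hasFDerivAt)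
  have hr : HasFDerivAt (fun z => pp * L z) (pp • fderiv ℝ L q) q :=
    (hdiff q hq).hasFDerivAt.const_mul pp
  have heq := hs.unique (hr.congr_of_eventuallyEq (by
    filter_upwards [hopen.mem_nhds hq] with z hz
    exact euler z hz))
  have hv := congrArg (fun A => A (q.2, fun k => -2 * G k q)) heq
  simp only [ContinuousLinearMap.sum_apply, ContinuousLinearMap.add_apply,
    ContinuousLinearMap.smul_apply, ContinuousLinearMap.comp_apply, smul_eq_mul,
    ContinuousLinearMap.coe_snd', ContinuousLinearMap.proj_apply, ← aux_spray,
    Finset.sum_add_distrib] at hv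
  have hlag : ∑ i, q.2 i * lagDiff n G L i q = (pp - 1) * sprayD n G L q := by
    have e : sprayD n G L q = (∑ k, q.2 k * pdx n L k q) - 2 * ∑ k, G k q * pdy n L k q := rfl
    have e2 : ∑ i, pdy n L i q * (-2 * G i q) = - (2 * ∑ k, G k q * pdy n L k q) := by
      rw [Finset.mul_sum, ← Finset.sum_neg_distrib]
      exact Finset.sum_congr rfl fun i _ => by ring
    simp only [lagDiff, mul_sub, Finset.sum_sub_distrib]
    linarith
  rw [← euler q hq, ← hlag, Finset.sum_mul, Finset.sum_mul]
  refine Finset.sum_congr rfl fun i _ => ?_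
  linear_combination q.2 i * hwedge i j q hq
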